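/- For α ∈ V*, where V := range(M − Id), the element (1/2)(M − M⁻¹)(h(ᾱ)) of g is independent of the choice of a linear extension ᾱ ∈ g* of α, lies in V, and the resulting linear map P♯ : V* → V is skew: α(P♯(β)) = −β(P♯(α)) for all α, β ∈ V*. Moreover, with σ the alternating form on V determined by σ((M − Id)(ξ), (M − Id)(η)) = (1/2)(B(ξ, M(η)) − B(η, M(ξ))), and with τ : V → V the restriction to V of 2·Id − M − M⁻¹ (which maps V to itself, and equals the fiberwise operator ρ of the momentum-duality formalism for the inclusion of a conjugacy class), one has the momentum duality σ♭ ∘ P♯ = Id_{V*} − (1/4)τ*, where σ♭ : V → V* is the adjoint of σ and τ* : V* → V* is the dual of τ. -/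

import Mathlib

/-- The (right-translated) tangent space `V = range(M − Id)` of a conjugacy class,
where `M` plays the role of `Ad_q`. -/
def conjTangent (K : Type*) {g : Type*} [Field K] [AddCommGroup g] [Module K g]
    (M : g ≃ₗ[K] g) : Submodule K g :=
  LinearMap.range ((M : g →ₗ[K] g) - LinearMap.id)

theorem mem_conjTangent (K : Type*) {g : Type*} [Field K] [AddCommGroup g] [Module K g]
    (M : g ≃ₗ[K] g) (ξ : g) : M ξ - ξ ∈ conjTangent K M := by
  show M ξ - ξ ∈ LinearMap.range ((M : g →ₗ[K] g) - LinearMap.id)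
  rw [LinearMap.mem_range]
  exact ⟨ξ, by simp⟩

theorem orthogonal_symm_apply {K g : Type*} [Field K] [AddCommGroup g] [Module K g]
    {ψ : g ≃ₗ[K] Module.Dual K g} {M : g ≃ₗ[K] g}
    (horth : ∀ x y : g, ψ (M x) (M y) = ψ x y) (x y : g) :
    ψ (M.symm x) y = ψ x (M y) := by
  simpa using (horth (M.symm x) y).symm

theorem exists_of_mem_conjTangent {K g : Type*} [Field K] [AddCommGroup g] [Module K g]
    {M : g ≃ₗ[K] g} {v : g} (hv : v ∈ conjTangent K M) : ∃ η, M η - η = v := by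
  obtain ⟨η, hη⟩ := LinearMap.mem_range.mp hv
  exact ⟨η, by simpa using hη⟩

/-- The annihilator of `conjTangent K M` corresponds under `ψ` to fixed vectors of `M`. -/
theorem map_eq_self_of_annihilates {K g : Type*} [Field K] [AddCommGroup g] [Module K g]
    {ψ : g ≃ₗ[K] Module.Dual K g} {M : g ≃ₗ[K] g}
    (horth : ∀ x y : g, ψ (M x) (M y) = ψ x y) {x : g}
    (hx : ∀ v ∈ conjTangent K M, ψ x v = 0) : M x = x := by
  have h : M.symm x = x := ψ.injective <| LinearMap.ext fun η => by
    rw [orthogonal_symm_apply horth]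
    simpa [sub_eq_zero] using hx _ (mem_conjTangent K M η)
  exact (M.symm_apply_eq.mp h).symm

theorem half_sub_symm_eq {K g : Type*} [Field K] [AddCommGroup g] [Module K g]
    (M : g ≃ₗ[K] g) (x : g) :
    (2 : K)⁻¹ • (M x - M.symm x) =
      M ((2 : K)⁻¹ • (x + M.symm x)) - (2 : K)⁻¹ • (x + M.symm x) := by
  rw [map_smul, map_add, M.apply_symm_apply]
  module

theorem half_sub_symm_mem_conjTangent {K g : Type*} [Field K] [AddCommGroup g] [Module K g]
    (M : g ≃ₗ[K] g) (x : g) : (2 : K)⁻¹ • (M x - M.symm x) ∈ conjTangent K M :=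
  half_sub_symm_eq M x ▸ mem_conjTangent K M _

/-- for `α ∈ V*` with `V = range(M − Id)`, the element
`(1/2)(M − M⁻¹)(h(ᾱ))` is independent of the chosen extension `ᾱ ∈ g*` of `α`, lies in
`V`, and the resulting map `P♯ : V* → V` is skew; moreover, with `σ` the canonical
2-form of the conjugacy class and `τ` the restriction to `V` of `2·Id − M − M⁻¹`
(which maps `V` into itself), one has the momentum duality
`σ♭ ∘ P♯ = Id − (1/4)τ*`. -/
theorem statement19 (K g : Type*) [Field K] [CharZero K]
    [AddCommGroup g] [Module K g] [FiniteDimensional K g]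
    (ψ : g ≃ₗ[K] Module.Dual K g) (hψsym : ∀ x y : g, ψ x y = ψ y x)
    (M : g ≃ₗ[K] g) (horth : ∀ x y : g, ψ (M x) (M y) = ψ x y) :
    (∀ ᾱ ᾱ' : Module.Dual K g,
      (∀ v : ↥(conjTangent K M), ᾱ (v : g) = ᾱ' (v : g)) →
      (2 : K)⁻¹ • (M (ψ.symm ᾱ) - M.symm (ψ.symm ᾱ)) =
        (2 : K)⁻¹ • (M (ψ.symm ᾱ') - M.symm (ψ.symm ᾱ'))) ∧
    (∀ ᾱ : Module.Dual K g,
      (2 : K)⁻¹ • (M (ψ.symm ᾱ) - M.symm (ψ.symm ᾱ)) ∈ conjTangent K M) ∧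
    (∀ v : ↥(conjTangent K M),
      (2 : K) • (v : g) - M (v : g) - M.symm (v : g) ∈ conjTangent K M) ∧
    (∃ P : Module.Dual K ↥(conjTangent K M) →ₗ[K] ↥(conjTangent K M),
      (∀ (α : Module.Dual K ↥(conjTangent K M)) (ᾱ : Module.Dual K g),
        (∀ v : ↥(conjTangent K M), ᾱ (v : g) = α v) →
        ((P α : g) = (2 : K)⁻¹ • (M (ψ.symm ᾱ) - M.symm (ψ.symm ᾱ)))) ∧
      (∀ α β : Module.Dual K ↥(conjTangent K M), α (P β) = - β (P α)) ∧
      (∀ σ : ↥(conjTangent K M) →ₗ[K] ↥(conjTangent K M) →ₗ[K] K,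
        (∀ ξ η : g,
          σ ⟨M ξ - ξ, mem_conjTangent K M ξ⟩ ⟨M η - η, mem_conjTangent K M η⟩ =
            (2 : K)⁻¹ * (ψ ξ (M η) - ψ η (M ξ))) →
        ∀ τ : ↥(conjTangent K M) →ₗ[K] ↥(conjTangent K M),
          (∀ v : ↥(conjTangent K M),
            (τ v : g) = (2 : K) • (v : g) - M (v : g) - M.symm (v : g)) →
          ∀ (α : Module.Dual K ↥(conjTangent K M)) (v : ↥(conjTangent K M)),
            σ (P α) v = α v - (4 : K)⁻¹ * α (τ v))) := by
  have hindep : ∀ ᾱ ᾱ' : Module.Dual K g,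
      (∀ v : ↥(conjTangent K M), ᾱ (v : g) = ᾱ' (v : g)) →
      (2 : K)⁻¹ • (M (ψ.symm ᾱ) - M.symm (ψ.symm ᾱ)) =
        (2 : K)⁻¹ • (M (ψ.symm ᾱ') - M.symm (ψ.symm ᾱ')) := by
    intro ᾱ ᾱ' h
    have hfix : M (ψ.symm (ᾱ - ᾱ')) = ψ.symm (ᾱ - ᾱ') :=
      map_eq_self_of_annihilates horth fun v hv => by simp [h ⟨v, hv⟩]
    have hfix' := M.symm_apply_eq.mpr hfix.symm
    simp only [map_sub] at hfix hfix'
    rw [sub_eq_sub_iff_sub_eq_sub.mp (hfix.trans hfix'.symm)]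
  obtain ⟨π, hπ⟩ := (conjTangent K M).subtype.exists_leftInverse_of_injective
    (conjTangent K M).ker_subtype
  have hext : ∀ (α : Module.Dual K ↥(conjTangent K M)) (v : ↥(conjTangent K M)),
      ψ (ψ.symm (α ∘ₗ π)) v = α v := fun α v => by
    simpa using congrArg α (LinearMap.congr_fun hπ v)
  let P : Module.Dual K ↥(conjTangent K M) →ₗ[K] ↥(conjTangent K M) :=
    LinearMap.codRestrict (conjTangent K M)
      (((2 : K)⁻¹ • ((M : g →ₗ[K] g) - (M.symm : g →ₗ[K] g))) ∘ₗ
        (ψ.symm : Module.Dual K g →ₗ[K] g) ∘ₗ π.dualMap)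
      fun α => half_sub_symm_mem_conjTangent M (ψ.symm (α ∘ₗ π))
  have hP : ∀ α, (P α : g) =
      (2 : K)⁻¹ • (M (ψ.symm (α ∘ₗ π)) - M.symm (ψ.symm (α ∘ₗ π))) := fun _ => rfl
  refine ⟨hindep, fun ᾱ => half_sub_symm_mem_conjTangent M _, fun v => ?_, P,
    fun α ᾱ h => ?_, fun α β => ?_, fun σ hσ τ hτ α v => ?_⟩
  · have h : (2 : K) • (v : g) - M v - M.symm v =
        (M (M.symm v) - M.symm v) - (M v - v) := by
      rw [M.apply_symm_apply]
      module
    exact h ▸ sub_mem (mem_conjTangent K M _) (mem_conjTangent K M _)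
  · refine hindep (α ∘ₗ π) ᾱ fun w => ?_
    rw [h, ← hext, ψ.apply_symm_apply]
  · rw [← hext, ← hext β, hP, hP]
    generalize ψ.symm (α ∘ₗ π) = x
    generalize ψ.symm (β ∘ₗ π) = y
    simp only [map_sub, map_smul, smul_eq_mul]
    rw [hψsym x (M.symm y), hψsym y (M.symm x), orthogonal_symm_apply horth,
      orthogonal_symm_apply horth]
    ring
  · obtain ⟨η, hη⟩ := exists_of_mem_conjTangent v.2
    obtain rfl : v = ⟨M η - η, mem_conjTangent K M η⟩ := Subtype.ext hη.symm
    rw [← hext α, ← hext α, hτ,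
      show P α = ⟨_, mem_conjTangent K M _⟩ from
        Subtype.ext ((hP α).trans (half_sub_symm_eq M _)), hσ]
    generalize ψ.symm (α ∘ₗ π) = x
    have h4 : (4 : K)⁻¹ = 2⁻¹ * 2⁻¹ := by norm_num
    simp only [map_sub, map_add, map_smul, smul_eq_mul, LinearMap.add_apply,
      LinearMap.smul_apply, M.apply_symm_apply, M.symm_apply_apply, h4]
    rw [orthogonal_symm_apply horth, hψsym η (M x), hψsym η x,
      ← M.apply_symm_apply η, horth x, M.apply_symm_apply]
    field_simp
    ring
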